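/- The δ²-Stokeslet term at the fiber surface: there exist constants C > 0 and ε₀ > 0, depending only on c_Γ and κ_max, such that for all 0 < ε < ε₀, 0 < δ < ε₀, every f ∈ C¹(ℝ/ℤ; ℝ³), every s ∈ ℝ/ℤ and θ ∈ [0,2π), the quantity S₃ = ∫_{−1/2}^{1/2} δ²/(|R(s,s̄,θ)|² + δ²)^{3/2} f(s − s̄) ds̄ satisfies |S₃ − (2δ²/(ε² + δ²)) f(s)| ≤ C (δ²/(ε² + δ²)^{1/2}) ‖f‖_{C¹}. -/

import Mathlib

open MeasureTheory

noncomputable section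

local notation "⟪" x ", " y "⟫" => @inner ℝ _ _ x y

abbrev V3 : Type := EuclideanSpace ℝ (Fin 3)

/-- The `C⁰` (sup) norm of a function `ℝ/ℤ → ℝ³`. -/
def C0norm (f : ℝ → V3) : ℝ := ⨆ s : ℝ, ‖f s‖

/-- The `C¹` norm of a function `ℝ/ℤ → ℝ³`. -/
def C1norm (f : ℝ → V3) : ℝ := C0norm f + C0norm (deriv f)

/-- The radial unit vector `e_ρ(s,θ) = cos θ e_{n1}(s) + sin θ e_{n2}(s)`. -/
def ePerp (en1 en2 : ℝ → V3) (s θ : ℝ) : V3 :=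
  Real.cos θ • en1 s + Real.sin θ • en2 s

/-- `R(s, s̄, θ) = X(s) + ε e_ρ(s,θ) − X(s − s̄)`. -/
def Rvec (X en1 en2 : ℝ → V3) (ε s sb θ : ℝ) : V3 :=
  X s + ε • ePerp en1 en2 s θ - X (s - sb)

/-- The slender-body geometry hypotheses: `X : ℝ/ℤ → ℝ³` is a `C²` closed curve
parameterized by arclength, non-self-intersecting with constant `cΓ`, with curvature
bounded by `κmax`, together with a `C¹` orthonormal frame `(X', en1, en2)`. -/
structure SlenderGeom (cΓ κmax : ℝ) (X en1 en2 : ℝ → V3) : Prop where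
  smooth : ContDiff ℝ 2 X
  periodicX : ∀ s, X (s + 1) = X s
  arclength : ∀ s, ‖deriv X s‖ = 1
  no_self_intersect : ∀ s t : ℝ, |s - t| ≤ 1 / 2 → cΓ * |s - t| ≤ ‖X s - X t‖
  curvature_max : ∀ s, ‖deriv (deriv X) s‖ ≤ κmax
  en1_smooth : ContDiff ℝ 1 en1
  en2_smooth : ContDiff ℝ 1 en2
  en1_periodic : ∀ s, en1 (s + 1) = en1 s
  en2_periodic : ∀ s, en2 (s + 1) = en2 s
  en1_unit : ∀ s, ‖en1 s‖ = 1
  en2_unit : ∀ s, ‖en2 s‖ = 1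
  es_en1 : ∀ s, ⟪deriv X s, en1 s⟫ = 0
  es_en2 : ∀ s, ⟪deriv X s, en2 s⟫ = 0
  en1_en2 : ∀ s, ⟪en1 s, en2 s⟫ = 0

/-- The singular Stokeslet `S(y) v = v/|y| + (y·v) y/|y|³`. -/
def stokeslet (y v : V3) : V3 := ‖y‖⁻¹ • v + (‖y‖ ^ 3)⁻¹ • ⟪y, v⟫ • y

/-- The singular doublet `D(y) v = v/|y|³ − 3 (y·v) y/|y|⁵`. -/
def doubletK (y v : V3) : V3 := (‖y‖ ^ 3)⁻¹ • v - (3 * (‖y‖ ^ 5)⁻¹) • ⟪y, v⟫ • y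

/-- The regularized Stokeslet `S_δ(y) v`. -/
def stokesletReg (δ : ℝ) (y v : V3) : V3 :=
  ((‖y‖ ^ 2 + δ ^ 2) ^ ((1 : ℝ) / 2))⁻¹ • v
    + ((‖y‖ ^ 2 + δ ^ 2) ^ ((3 : ℝ) / 2))⁻¹ • (⟪y, v⟫ • y + δ ^ 2 • v)

/-- The regularized doublet `D_δ(y) v`. -/
def doubletReg (δ : ℝ) (y v : V3) : V3 :=
  ((‖y‖ ^ 2 + δ ^ 2) ^ ((3 : ℝ) / 2))⁻¹ • v
    - (3 * ((‖y‖ ^ 2 + δ ^ 2) ^ ((5 : ℝ) / 2))⁻¹) • (⟪y, v⟫ • y + δ ^ 2 • v)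

/-- The classical slender-body velocity `u^SB(x)` with doublet coefficient `ε²/2`. -/
def uSB (X f : ℝ → V3) (ε : ℝ) (x : V3) : V3 :=
  (8 * Real.pi)⁻¹ • ∫ t in (0:ℝ)..1,
    (stokeslet (x - X t) (f t) + (ε ^ 2 / 2) • doubletK (x - X t) (f t))

/-- The regularized slender-body velocity with doublet coefficient `β`. -/
def uReg (X f : ℝ → V3) (β δ : ℝ) (x : V3) : V3 :=
  (8 * Real.pi)⁻¹ • ∫ t in (0:ℝ)..1,
    (stokesletReg δ (x - X t) (f t) + β • doubletReg δ (x - X t) (f t))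

/-- The Keller–Rubinow classical centerline velocity `u^SB_C(X(s))`. -/
def uSBC (X f : ℝ → V3) (ε s : ℝ) : V3 :=
  (8 * Real.pi)⁻¹ •
    ((f s - (3 : ℝ) • ⟪deriv X s, f s⟫ • deriv X s
        - (2 * Real.log (Real.pi * ε / 4)) • (f s + ⟪deriv X s, f s⟫ • deriv X s))
      + ∫ t in (0:ℝ)..1,
          ((‖X s - X t‖⁻¹ • f t
              + (‖X s - X t‖ ^ 3)⁻¹ • ⟪X s - X t, f t⟫ • (X s - X t))
            - |Real.sin (Real.pi * (s - t)) / Real.pi|⁻¹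
                • (f s + ⟪deriv X s, f s⟫ • deriv X s)))

/-- The regularized pressure `p^δ(x)`. -/
def pReg (X f : ℝ → V3) (δ : ℝ) (x : V3) : ℝ :=
  (4 * Real.pi)⁻¹ * ∫ t in (0:ℝ)..1,
    (⟪x - X t, f t⟫ * ((‖x - X t‖ ^ 2 + δ ^ 2) ^ ((3 : ℝ) / 2))⁻¹
      + 3 * δ ^ 2 * ⟪x - X t, f t⟫ * (2 * (‖x - X t‖ ^ 2 + δ ^ 2) ^ ((5 : ℝ) / 2))⁻¹)

/-- The symmetric strain tensor `E(u) = (∇u + (∇u)ᵀ)/2` applied to the vector `n`. -/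
def strainApply (u : V3 → V3) (x n : V3) : V3 :=
  (2 : ℝ)⁻¹ • (fderiv ℝ u x n + gradient (fun y => ⟪u y, n⟫) x)

/-- The surface Jacobian `J_ε(s,θ) = ε(1 − ε(κ₁ cos θ + κ₂ sin θ))`. -/
def Jfac (X en1 en2 : ℝ → V3) (ε s θ : ℝ) : ℝ :=
  ε * (1 - ε * (⟪deriv (deriv X) s, en1 s⟫ * Real.cos θ
      + ⟪deriv (deriv X) s, en2 s⟫ * Real.sin θ))

/-- The regularized surface force density
`f^δ(s) = ∫_0^{2π} (2 E(u^δ) n − p^δ n) J_ε dθ`, with `n = −e_ρ`. -/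
def fReg (X en1 en2 f : ℝ → V3) (ε δ s : ℝ) : V3 :=
  ∫ θ in (0:ℝ)..(2 * Real.pi),
    Jfac X en1 en2 ε s θ •
      ((2 : ℝ) • strainApply (uReg X f ((ε ^ 2 + δ ^ 2) / 2) δ)
          (X s + ε • ePerp en1 en2 s θ) (-ePerp en1 en2 s θ)
        - pReg X f δ (X s + ε • ePerp en1 en2 s θ) • (-ePerp en1 en2 s θ))

/-- The vector field `d_n^δ[f](x)`. -/
def dReg (X f : ℝ → V3) (δ : ℝ) (n : ℕ) (x : V3) : V3 :=
  (8 * Real.pi)⁻¹ • ∫ t in (0:ℝ)..1,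
    (δ ^ 2 * ((‖x - X t‖ ^ 2 + δ ^ 2) ^ ((n : ℝ) / 2))⁻¹) • f t

/-- The scalar field `d_5^δ[f·R](x)`. -/
def dRegP (X f : ℝ → V3) (δ : ℝ) (x : V3) : ℝ :=
  (8 * Real.pi)⁻¹ * ∫ t in (0:ℝ)..1,
    δ ^ 2 * ⟪x - X t, f t⟫ * ((‖x - X t‖ ^ 2 + δ ^ 2) ^ ((5 : ℝ) / 2))⁻¹

/-- The extra force contribution
`F^δ(s) = ∫_0^{2π} (2E(d₃^δ[f])n − 3(ε²+δ²)E(d₅^δ[f])n − 3 d₅^δ[f·R] n) J_ε dθ`. -/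
def Fextra (X en1 en2 f : ℝ → V3) (ε δ s : ℝ) : V3 :=
  ∫ θ in (0:ℝ)..(2 * Real.pi),
    Jfac X en1 en2 ε s θ •
      ((2 : ℝ) • strainApply (dReg X f δ 3) (X s + ε • ePerp en1 en2 s θ)
          (-ePerp en1 en2 s θ)
        - (3 * (ε ^ 2 + δ ^ 2)) • strainApply (dReg X f δ 5)
            (X s + ε • ePerp en1 en2 s θ) (-ePerp en1 en2 s θ)
        - (3 * dRegP X f δ (X s + ε • ePerp en1 en2 s θ)) • (-ePerp en1 en2 s θ))

/-! ### Norms of periodic functions -/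

lemma norm_le_C0norm {f : ℝ → V3} (hf : Continuous f) (hp : ∀ s, f (s + 1) = f s) (s : ℝ) :
    ‖f s‖ ≤ C0norm f := by
  have hper : Function.Periodic (fun s => ‖f s‖) 1 := fun s => by simp [hp s]
  exact le_ciSup (hper.isBounded_of_continuous one_ne_zero hf.norm).bddAbove s

lemma deriv_add_one_of_periodic {f : ℝ → V3} (hp : ∀ s, f (s + 1) = f s) (s : ℝ) :
    deriv f (s + 1) = deriv f s := by
  have h : (fun x => f (x + 1)) = f := funext hp
  rw [← deriv_comp_add_const, h]

/-- A `C¹` function with derivative bounded by `M` is `M`-Lipschitz. -/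
lemma norm_sub_le_of_norm_deriv_le {f : ℝ → V3} (hf : Differentiable ℝ f) {M : ℝ}
    (hM : ∀ s, ‖deriv f s‖ ≤ M) (s t : ℝ) : ‖f s - f t‖ ≤ M * |s - t| := by
  have := Convex.norm_image_sub_le_of_norm_deriv_le (f := f) (s := Set.univ) (C := M)
    (fun x _ => hf x) (fun x _ => hM x) convex_univ (Set.mem_univ t) (Set.mem_univ s)
  simpa [Real.norm_eq_abs] using this

/-! ### Model integrals -/

lemma rpow_three_halves {x : ℝ} (hx : 0 ≤ x) : x ^ ((3 : ℝ) / 2) = √x ^ 3 := by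
  rw [Real.sqrt_eq_rpow, ← Real.rpow_mul_natCast hx]
  norm_num

lemma continuous_inv_sq_add_sq {η : ℝ} (hη : 0 < η) :
    Continuous fun t : ℝ => (t ^ 2 + η ^ 2)⁻¹ :=
  Continuous.inv₀ (by fun_prop) fun t => by positivity

lemma continuous_inv_sqrt_cube {g : ℝ → ℝ} (hg : Continuous g) (hpos : ∀ t, 0 < g t) :
    Continuous fun t : ℝ => (√(g t) ^ 3)⁻¹ :=
  Continuous.inv₀ (by fun_prop) fun t => by
    have := Real.sqrt_pos.2 (hpos t)
    positivity

lemma integral_inv_sq_add_sq_le {η : ℝ} (hη : 0 < η) :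
    ∫ t in (-(1:ℝ)/2)..(1/2), (t ^ 2 + η ^ 2)⁻¹ ≤ Real.pi / η := by
  have hd : ∀ t ∈ Set.uIcc (-(1:ℝ)/2) (1/2),
      HasDerivAt (fun t => η⁻¹ * Real.arctan (t / η)) ((t ^ 2 + η ^ 2)⁻¹) t := by
    intro t _
    have h := (((hasDerivAt_id t).div_const η).arctan).const_mul η⁻¹
    refine h.congr_deriv ?_
    have : 0 < t ^ 2 + η ^ 2 := by positivity
    have : 0 < 1 + (t / η) ^ 2 := by positivity
    simp only [id]
    field_simp
    ring
  rw [intervalIntegral.integral_eq_sub_of_hasDerivAt hd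
    ((continuous_inv_sq_add_sq hη).intervalIntegrable _ _), ← mul_sub, div_eq_inv_mul Real.pi]
  have h1 := Real.arctan_lt_pi_div_two (1 / 2 / η)
  have h2 := Real.neg_pi_div_two_lt_arctan (-1 / 2 / η)
  have h3 : Real.arctan (1 / 2 / η) - Real.arctan (-1 / 2 / η) ≤ Real.pi := by linarith
  exact mul_le_mul_of_nonneg_left h3 (inv_nonneg.2 hη.le)

lemma abs_integral_inv_sqrt_cube_sub_le {η : ℝ} (hη : 0 < η) :
    |(∫ t in (-(1:ℝ)/2)..(1/2), (√(t ^ 2 + η ^ 2) ^ 3)⁻¹) - 2 / η ^ 2| ≤ 4 / η := by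
  have hd : ∀ t ∈ Set.uIcc (-(1:ℝ)/2) (1/2),
      HasDerivAt (fun t => t / (η ^ 2 * √(t ^ 2 + η ^ 2))) ((√(t ^ 2 + η ^ 2) ^ 3)⁻¹) t := by
    intro t _
    have hB : 0 < t ^ 2 + η ^ 2 := by positivity
    have hb := Real.sqrt_pos.2 hB
    have h0 : HasDerivAt (fun t : ℝ => t ^ 2 + η ^ 2) (2 * t) t := by
      simpa using (hasDerivAt_pow 2 t).add_const (η ^ 2)
    have h := (hasDerivAt_id t).div ((h0.sqrt hB.ne').const_mul (η ^ 2)) (by positivity)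
    refine h.congr_deriv ?_
    have hs := Real.sq_sqrt hB.le
    simp only [id]
    set b := √(t ^ 2 + η ^ 2)
    field_simp
    linear_combination hs
  have hc : Continuous fun t : ℝ => (√(t ^ 2 + η ^ 2) ^ 3)⁻¹ :=
    continuous_inv_sqrt_cube (by fun_prop) fun t => by positivity
  rw [intervalIntegral.integral_eq_sub_of_hasDerivAt hd (hc.intervalIntegrable _ _)]
  have hsq : ((-1 : ℝ) / 2) ^ 2 = (1 / 2) ^ 2 := by norm_num
  rw [hsq]
  have hB : 0 < ((1 : ℝ) / 2) ^ 2 + η ^ 2 := by positivity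
  have hs := Real.sq_sqrt hB.le
  have hle : (1 : ℝ) / 2 ≤ √((1 / 2) ^ 2 + η ^ 2) := Real.le_sqrt_of_sq_le (by nlinarith)
  have hle' : √((1 / 2) ^ 2 + η ^ 2) ≤ 1 / 2 + η :=
    Real.sqrt_le_iff.2 ⟨by positivity, by nlinarith⟩
  set q := √((1 / 2) ^ 2 + η ^ 2)
  have hq : 0 < q := by linarith
  have e : 1 / 2 / (η ^ 2 * q) - -1 / 2 / (η ^ 2 * q) - 2 / η ^ 2
      = -((2 * q - 1) / (η ^ 2 * q)) := by
    field_simp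
    ring
  rw [e, abs_neg, abs_of_nonneg (div_nonneg (by linarith) (by positivity)),
    div_le_div_iff₀ (by positivity) hη]
  nlinarith [mul_le_mul_of_nonneg_left hle (sq_nonneg η)]

/-! ### Comparison of the kernels -/

lemma abs_inv_cube_sub_inv_cube_le {a b c k : ℝ} (hb : 0 < b) (hc : 0 < c) (hc1 : c ≤ 1)
    (hcb : c * b ≤ a) (hk : 0 ≤ k) (hab : |a ^ 2 - b ^ 2| ≤ k * b ^ 3) :
    |(a ^ 3)⁻¹ - (b ^ 3)⁻¹| ≤ 3 * k / c ^ 3 * (b ^ 2)⁻¹ := by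
  have ha : 0 < a := lt_of_lt_of_le (by positivity) hcb
  have hdiff : |a - b| ≤ k * b ^ 2 := by
    have h1 : |a - b| * b ≤ |a ^ 2 - b ^ 2| := by
      rw [show a ^ 2 - b ^ 2 = (a - b) * (a + b) by ring, abs_mul, abs_of_pos (add_pos ha hb)]
      gcongr
      linarith
    have h2 : |a - b| * b ≤ k * b ^ 2 * b := by linarith [h1.trans hab, pow_succ b 2]
    exact le_of_mul_le_mul_right h2 hb
  have e : (a ^ 3)⁻¹ - (b ^ 3)⁻¹
      = -((a - b) * ((a * b ^ 3)⁻¹ + (a ^ 2 * b ^ 2)⁻¹ + (a ^ 3 * b)⁻¹)) := by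
    field_simp
    ring
  have hc2 : c ^ 3 ≤ c := by
    simpa using pow_le_pow_of_le_one hc.le hc1 (show 1 ≤ 3 by norm_num)
  have hc3 : c ^ 3 ≤ c ^ 2 := pow_le_pow_of_le_one hc.le hc1 (by norm_num)
  have i1 : (a * b ^ 3)⁻¹ ≤ (c ^ 3 * b ^ 4)⁻¹ := by
    refine inv_anti₀ (by positivity) ?_
    calc c ^ 3 * b ^ 4 ≤ c * b ^ 4 := by gcongr
      _ = c * b * b ^ 3 := by ring
      _ ≤ a * b ^ 3 := by gcongr
  have i2 : (a ^ 2 * b ^ 2)⁻¹ ≤ (c ^ 3 * b ^ 4)⁻¹ := by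
    refine inv_anti₀ (by positivity) ?_
    calc c ^ 3 * b ^ 4 ≤ c ^ 2 * b ^ 4 := by gcongr
      _ = (c * b) ^ 2 * b ^ 2 := by ring
      _ ≤ a ^ 2 * b ^ 2 := by gcongr
  have i3 : (a ^ 3 * b)⁻¹ ≤ (c ^ 3 * b ^ 4)⁻¹ := by
    refine inv_anti₀ (by positivity) ?_
    calc c ^ 3 * b ^ 4 = (c * b) ^ 3 * b := by ring
      _ ≤ a ^ 3 * b := by gcongr
  rw [e, abs_neg, abs_mul, abs_of_nonneg (a := _ + _ + _) (by positivity)]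
  calc |a - b| * ((a * b ^ 3)⁻¹ + (a ^ 2 * b ^ 2)⁻¹ + (a ^ 3 * b)⁻¹)
      ≤ (k * b ^ 2) * (3 * (c ^ 3 * b ^ 4)⁻¹) := by
        gcongr
        linarith
    _ = 3 * k / c ^ 3 * (b ^ 2)⁻¹ := by
        field_simp

namespace SlenderGeom

variable {cΓ κmax : ℝ} {X en1 en2 : ℝ → V3}

lemma norm_ePerp (hG : SlenderGeom cΓ κmax X en1 en2) (s θ : ℝ) :
    ‖ePerp en1 en2 s θ‖ = 1 := by
  have h : ‖ePerp en1 en2 s θ‖ ^ 2 = 1 := by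
    rw [ePerp, norm_add_sq_real, norm_smul, norm_smul, hG.en1_unit, hG.en2_unit,
      inner_smul_left, inner_smul_right, hG.en1_en2]
    simp [Real.cos_sq_add_sin_sq]
  exact (pow_eq_one_iff_of_nonneg (norm_nonneg _) two_ne_zero).1 h

lemma inner_ePerp_deriv (hG : SlenderGeom cΓ κmax X en1 en2) (s θ : ℝ) :
    ⟪ePerp en1 en2 s θ, deriv X s⟫ = 0 := by
  rw [real_inner_comm, ePerp, inner_add_right, inner_smul_right, inner_smul_right,
    hG.es_en1, hG.es_en2]
  simp

lemma norm_sub_le (hG : SlenderGeom cΓ κmax X en1 en2) (s t : ℝ) :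
    ‖X s - X (s - t)‖ ≤ |t| := by
  have := norm_sub_le_of_norm_deriv_le (hG.smooth.differentiable (by norm_num))
    (fun s => (hG.arclength s).le) s (s - t)
  simpa using this

lemma norm_taylor_le (hG : SlenderGeom cΓ κmax X en1 en2) (s t : ℝ) :
    ‖X s - X (s - t) - t • deriv X s‖ ≤ κmax * t ^ 2 := by
  have hX : Differentiable ℝ X := hG.smooth.differentiable (by norm_num)
  have hX' : Differentiable ℝ (deriv X) :=
    (hG.smooth.iterate_deriv' 1 1).differentiable (by norm_num)
  have hκ : 0 ≤ κmax := (norm_nonneg _).trans (hG.curvature_max 0)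
  have hd : ∀ u : ℝ, HasDerivAt (fun u => X s - X (s - u) - u • deriv X s)
      (deriv X (s - u) - deriv X s) u := by
    intro u
    have h1 : HasDerivAt (fun u : ℝ => X (s - u)) (-deriv X (s - u)) u := by
      simpa [Function.comp_def] using
        (hX (s - u)).hasDerivAt.scomp u ((hasDerivAt_id u).const_sub s)
    have h2 : HasDerivAt (fun u : ℝ => u • deriv X s) (deriv X s) u := by
      simpa using (hasDerivAt_id u).smul_const (deriv X s)
    exact ((h1.const_sub (X s)).sub h2).congr_deriv (by simp)
  have h := Convex.norm_image_sub_le_of_norm_hasDerivWithin_le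
    (f := fun u => X s - X (s - u) - u • deriv X s) (s := Set.uIcc 0 t) (C := κmax * |t|)
    (fun u _ => (hd u).hasDerivWithinAt)
    (fun u hu => by
      have h := norm_sub_le_of_norm_deriv_le hX' hG.curvature_max (s - u) s
      have hu' : |u| ≤ |t| := by simpa using Set.abs_sub_left_of_mem_uIcc hu
      refine h.trans ?_
      rw [show s - u - s = -u by ring, abs_neg]
      gcongr)
    (convex_uIcc 0 t) Set.left_mem_uIcc Set.right_mem_uIcc
  simp only [sub_zero, sub_self, zero_smul, Real.norm_eq_abs, mul_assoc, abs_mul_abs_self] at h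
  simpa [pow_two] using h

/-- The squared distance from a surface point to the centerline is `t² + ε²` up to cubic
errors. -/
lemma abs_norm_Rvec_sq_sub_le (hG : SlenderGeom cΓ κmax X en1 en2) {ε : ℝ} (hε : 0 < ε)
    (s t θ : ℝ) :
    |‖Rvec X en1 en2 ε s t θ‖ ^ 2 - (t ^ 2 + ε ^ 2)| ≤ 2 * κmax * (|t| + ε) * t ^ 2 := by
  have hκ : 0 ≤ κmax := (norm_nonneg _).trans (hG.curvature_max 0)
  have hr := hG.norm_taylor_le s t
  have hD := hG.norm_sub_le s t
  set D := X s - X (s - t) with hDdef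
  set e := ePerp en1 en2 s θ with he
  have hen : ‖e‖ = 1 := hG.norm_ePerp s θ
  have hR : Rvec X en1 en2 ε s t θ = D + ε • e := by
    simp only [Rvec, hDdef, he]
    abel
  have hin : ⟪D, e⟫ = ⟪D - t • deriv X s, e⟫ := by
    rw [inner_sub_left D, inner_smul_left, real_inner_comm e (deriv X s),
      hG.inner_ePerp_deriv s θ]
    simp
  have hin' : |⟪D, e⟫| ≤ κmax * t ^ 2 := by
    rw [hin]
    exact (abs_real_inner_le_norm _ _).trans (by rw [hen, mul_one]; exact hr)
  have hlow : |t| - κmax * t ^ 2 ≤ ‖D‖ := by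
    have h1 : ‖t • deriv X s‖ = |t| := by rw [norm_smul, hG.arclength]; simp
    have h2 := norm_sub_norm_le (t • deriv X s) D
    rw [norm_sub_rev _ D] at h2
    linarith
  have hsq : ‖D + ε • e‖ ^ 2 = ‖D‖ ^ 2 + 2 * ε * ⟪D, e⟫ + ε ^ 2 := by
    rw [norm_add_sq_real, norm_smul, hen, inner_smul_right, mul_one, Real.norm_eq_abs, sq_abs]
    ring
  have hDsq : |‖D‖ ^ 2 - t ^ 2| ≤ 2 * κmax * |t| * t ^ 2 := by
    rw [← sq_abs t] at hlow ⊢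
    have hD0 := norm_nonneg D
    have ht0 := abs_nonneg t
    rw [abs_le]
    constructor
    · nlinarith [mul_le_mul_of_nonneg_right hlow (add_nonneg hD0 ht0),
        mul_nonneg (mul_nonneg hκ (sq_nonneg |t|)) (sub_nonneg.2 hD)]
    · have : 0 ≤ κmax * |t| * |t| ^ 2 := by positivity
      nlinarith
  rw [hR, hsq]
  have e1 : ‖D‖ ^ 2 + 2 * ε * ⟪D, e⟫ + ε ^ 2 - (t ^ 2 + ε ^ 2)
      = (‖D‖ ^ 2 - t ^ 2) + 2 * ε * ⟪D, e⟫ := by ring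
  rw [e1]
  refine (abs_add_le _ _).trans ?_
  rw [abs_mul, abs_of_pos (show 0 < 2 * ε by positivity)]
  have := mul_le_mul_of_nonneg_left hin' (show 0 ≤ 2 * ε by positivity)
  linarith

/-- The distance from a surface point to the centerline is bounded below by a multiple of
`√(t² + ε²)`. -/
lemma sq_mul_le_norm_Rvec_sq (hG : SlenderGeom cΓ κmax X en1 en2) {k : ℝ} (hk : 0 < k)
    (hκk : κmax ≤ k) (hcΓ : 0 < cΓ) {ε : ℝ} (hε : 0 < ε)
    (hε₁ : ε ≤ 1 / (8 * k)) (hε₂ : ε ≤ cΓ / (16 * k)) {s t : ℝ} (ht : |t| ≤ 1 / 2) (θ : ℝ) :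
    min (cΓ / 3) (1 / 2) ^ 2 * (t ^ 2 + ε ^ 2) ≤ ‖Rvec X en1 en2 ε s t θ‖ ^ 2 := by
  have hc0 : 0 < min (cΓ / 3) (1 / 2) := lt_min (by positivity) (by norm_num)
  have hc1 := min_le_left (cΓ / 3) (1 / 2)
  have hc2 := min_le_right (cΓ / 3) (1 / 2)
  set c := min (cΓ / 3) (1 / 2)
  rcases le_or_gt |t| (1 / (8 * k)) with hsmall | hlarge
  · have h := (abs_le.1 (hG.abs_norm_Rvec_sq_sub_le hε s t θ)).1
    have h1 : 2 * κmax * (|t| + ε) ≤ 1 / 2 :=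
      calc 2 * κmax * (|t| + ε) ≤ 2 * k * (1 / (8 * k) + 1 / (8 * k)) := by gcongr
        _ = 1 / 2 := by field_simp; norm_num
    have h2 := mul_le_mul_of_nonneg_right h1 (sq_nonneg t)
    have h3 : c ^ 2 ≤ (1 / 2) ^ 2 := by gcongr
    have h4 := mul_le_mul_of_nonneg_right h3 (show 0 ≤ t ^ 2 + ε ^ 2 by positivity)
    nlinarith [sq_nonneg t, sq_nonneg ε]
  · have hεt : ε ≤ cΓ / 2 * |t| :=
      calc ε ≤ cΓ / (16 * k) := hε₂
        _ = cΓ / 2 * (1 / (8 * k)) := by field_simp; norm_num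
        _ ≤ cΓ / 2 * |t| := by gcongr
    have hD := hG.no_self_intersect s (s - t) (by simpa using ht)
    rw [sub_sub_cancel] at hD
    have hR : cΓ / 2 * |t| ≤ ‖Rvec X en1 en2 ε s t θ‖ := by
      have h1 : ‖ε • ePerp en1 en2 s θ‖ = ε := by
        rw [norm_smul, hG.norm_ePerp, mul_one, Real.norm_eq_abs, abs_of_pos hε]
      have h2 : X s - X (s - t) = Rvec X en1 en2 ε s t θ - ε • ePerp en1 en2 s θ := by
        simp only [Rvec]
        abel
      have h3 := _root_.norm_sub_le (Rvec X en1 en2 ε s t θ) (ε • ePerp en1 en2 s θ)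
      rw [← h2, h1] at h3
      linarith
    have hR2 : (cΓ / 2 * |t|) ^ 2 ≤ ‖Rvec X en1 en2 ε s t θ‖ ^ 2 := by gcongr
    have hε2 : ε ^ 2 ≤ (cΓ / 2 * |t|) ^ 2 := by gcongr
    have h5 : c ^ 2 ≤ (cΓ / 3) ^ 2 := by gcongr
    have h6 : c ^ 2 ≤ (1 / 2) ^ 2 := by gcongr
    rw [mul_pow, sq_abs] at hR2 hε2
    have h7 := mul_le_mul_of_nonneg_right h5 (sq_nonneg t)
    have h8 := mul_le_mul_of_nonneg_right h6 (sq_nonneg ε)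
    nlinarith [mul_nonneg (sq_nonneg cΓ) (sq_nonneg t)]

/-- On the fiber surface the regularized kernel agrees with that of a straight fiber up to an
error of one order lower. -/
lemma abs_kernel_sub_le (hG : SlenderGeom cΓ κmax X en1 en2) {k : ℝ} (hk : 0 < k)
    (hκk : κmax ≤ k) (hcΓ : 0 < cΓ) {ε : ℝ} (hε : 0 < ε)
    (hε₁ : ε ≤ 1 / (8 * k)) (hε₂ : ε ≤ cΓ / (16 * k)) (δ : ℝ) {s t : ℝ} (ht : |t| ≤ 1 / 2)
    (θ : ℝ) :
    |(√(‖Rvec X en1 en2 ε s t θ‖ ^ 2 + δ ^ 2) ^ 3)⁻¹ - (√(t ^ 2 + (ε ^ 2 + δ ^ 2)) ^ 3)⁻¹|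
      ≤ 3 * (4 * k) / min (cΓ / 3) (1 / 2) ^ 3 * (t ^ 2 + (ε ^ 2 + δ ^ 2))⁻¹ := by
  have hc0 : 0 < min (cΓ / 3) (1 / 2) := lt_min (by positivity) (by norm_num)
  have hc1 : min (cΓ / 3) (1 / 2) ≤ 1 := (min_le_right _ _).trans (by norm_num)
  have hlow := hG.sq_mul_le_norm_Rvec_sq hk hκk hcΓ hε hε₁ hε₂ (s := s) ht θ
  have hdiff := hG.abs_norm_Rvec_sq_sub_le hε s t θ
  set c := min (cΓ / 3) (1 / 2)
  set r := ‖Rvec X en1 en2 ε s t θ‖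
  have hB : 0 < t ^ 2 + (ε ^ 2 + δ ^ 2) := by positivity
  have hA : 0 ≤ r ^ 2 + δ ^ 2 := by positivity
  have hb := Real.sqrt_pos.2 hB
  have hb2 := Real.sq_sqrt hB.le
  have ha2 := Real.sq_sqrt hA
  have hcb : c * √(t ^ 2 + (ε ^ 2 + δ ^ 2)) ≤ √(r ^ 2 + δ ^ 2) := by
    refine Real.le_sqrt_of_sq_le ?_
    rw [mul_pow, hb2]
    have : c ^ 2 * δ ^ 2 ≤ 1 * δ ^ 2 := by
      gcongr
      exact pow_le_one₀ hc0.le hc1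
    linarith
  have htb : |t| ≤ √(t ^ 2 + (ε ^ 2 + δ ^ 2)) :=
    Real.le_sqrt_of_sq_le (by rw [sq_abs]; nlinarith [sq_nonneg ε, sq_nonneg δ])
  have hεb : ε ≤ √(t ^ 2 + (ε ^ 2 + δ ^ 2)) :=
    Real.le_sqrt_of_sq_le (by nlinarith [sq_nonneg t, sq_nonneg δ])
  set a := √(r ^ 2 + δ ^ 2)
  set b := √(t ^ 2 + (ε ^ 2 + δ ^ 2))
  rw [← hb2]
  refine abs_inv_cube_sub_inv_cube_le hb hc0 hc1 hcb (by positivity) ?_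
  rw [ha2, hb2, show r ^ 2 + δ ^ 2 - (t ^ 2 + (ε ^ 2 + δ ^ 2)) = r ^ 2 - (t ^ 2 + ε ^ 2) by ring]
  calc |r ^ 2 - (t ^ 2 + ε ^ 2)| ≤ 2 * κmax * (|t| + ε) * t ^ 2 := hdiff
    _ = 2 * κmax * (|t| + ε) * |t| ^ 2 := by rw [sq_abs]
    _ ≤ 2 * k * (b + b) * b ^ 2 := by gcongr
    _ = 4 * k * b ^ 3 := by ring

end SlenderGeom

/-- The `δ²`-Stokeslet term at the fiber surface:
`|S₃ − (2δ²/(ε²+δ²)) f(s)| ≤ C (δ²/√(ε²+δ²)) ‖f‖_{C¹}`. -/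
theorem surface_stokeslet_term_S3 (cΓ κmax : ℝ) (hcΓ : 0 < cΓ) :
    ∃ C > 0, ∃ ε₀ > 0,
      ∀ X en1 en2 : ℝ → V3, SlenderGeom cΓ κmax X en1 en2 →
      ∀ ε δ : ℝ, 0 < ε → ε < ε₀ → 0 < δ → δ < ε₀ →
      ∀ f : ℝ → V3, ContDiff ℝ 1 f → (∀ s, f (s + 1) = f s) →
      ∀ s θ : ℝ,
        ‖(∫ sb in (-(1:ℝ)/2)..(1/2),
              (δ ^ 2 * ((‖Rvec X en1 en2 ε s sb θ‖ ^ 2 + δ ^ 2) ^ ((3 : ℝ) / 2))⁻¹)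
                • f (s - sb))
            - (2 * δ ^ 2 / (ε ^ 2 + δ ^ 2)) • f s‖
          ≤ C * (δ ^ 2 / (ε ^ 2 + δ ^ 2) ^ ((1 : ℝ) / 2)) * C1norm f := by
  set k : ℝ := |κmax| + 1 with hkdef
  have hk : 0 < k := by positivity
  have hκk : κmax ≤ k := (le_abs_self κmax).trans (by linarith)
  have hc0 : 0 < min (cΓ / 3) (1 / 2) := lt_min (by positivity) (by norm_num)
  set K : ℝ := 3 * (4 * k) / min (cΓ / 3) (1 / 2) ^ 3 with hK
  have hK0 : 0 < K := by positivity
  refine ⟨(K + 1) * Real.pi + 4, by positivity, min (1 / (8 * k)) (cΓ / (16 * k)),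
    lt_min (by positivity) (by positivity), ?_⟩
  intro X en1 en2 hG ε δ hε hε₀ hδ _ f hf hfp s θ
  have hε₁ : ε ≤ 1 / (8 * k) := hε₀.le.trans (min_le_left _ _)
  have hε₂ : ε ≤ cΓ / (16 * k) := hε₀.le.trans (min_le_right _ _)
  have hf0 : ∀ t, ‖f t‖ ≤ C0norm f := norm_le_C0norm hf.continuous hfp
  have hf1 : ∀ t, ‖deriv f t‖ ≤ C0norm (deriv f) :=
    norm_le_C0norm (hf.continuous_deriv le_rfl) (deriv_add_one_of_periodic hfp)
  have hM0 : 0 ≤ C0norm f := (norm_nonneg _).trans (hf0 0)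
  have hM1 : 0 ≤ C0norm (deriv f) := (norm_nonneg _).trans (hf1 0)
  have hη2 : 0 < ε ^ 2 + δ ^ 2 := by positivity
  have hη := Real.sqrt_pos.2 hη2
  have hηsq := Real.sq_sqrt hη2.le
  have hker := fun t (ht : |t| ≤ 1 / 2) =>
    hG.abs_kernel_sub_le hk hκk hcΓ hε hε₁ hε₂ δ (s := s) ht θ
  simp only [← hK] at hker
  rw [← Real.sqrt_eq_rpow]
  have hrp : ∀ t, (‖Rvec X en1 en2 ε s t θ‖ ^ 2 + δ ^ 2) ^ ((3 : ℝ) / 2)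
      = √(‖Rvec X en1 en2 ε s t θ‖ ^ 2 + δ ^ 2) ^ 3 := fun t =>
    rpow_three_halves (by positivity)
  simp only [hrp, mul_smul, intervalIntegral.integral_smul]
  have hmain := abs_integral_inv_sqrt_cube_sub_le hη
  have hInt := integral_inv_sq_add_sq_le hη
  have hcinv := continuous_inv_sq_add_sq hη
  rw [hηsq] at hmain hInt hcinv
  set η := √(ε ^ 2 + δ ^ 2)
  set w : ℝ → ℝ := fun t => (√(‖Rvec X en1 en2 ε s t θ‖ ^ 2 + δ ^ 2) ^ 3)⁻¹
  set v : ℝ → ℝ := fun t => (√(t ^ 2 + (ε ^ 2 + δ ^ 2)) ^ 3)⁻¹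
  have hXc : Continuous X := hG.smooth.continuous
  have hfc : Continuous f := hf.continuous
  have hw : Continuous w := by
    refine continuous_inv_sqrt_cube ?_ fun t => by positivity
    unfold Rvec
    fun_prop
  have hv : Continuous v := continuous_inv_sqrt_cube (by fun_prop) fun t => by positivity
  have hpt : ∀ t, |t| ≤ 1 / 2 →
      ‖w t • f (s - t) - v t • f s‖
        ≤ (K + 1) * C1norm f * (t ^ 2 + (ε ^ 2 + δ ^ 2))⁻¹ := by
    intro t ht
    have hB : 0 < t ^ 2 + (ε ^ 2 + δ ^ 2) := by positivity
    have hb := Real.sqrt_pos.2 hB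
    have hb2 := Real.sq_sqrt hB.le
    have htb : |t| ≤ √(t ^ 2 + (ε ^ 2 + δ ^ 2)) :=
      Real.le_sqrt_of_sq_le (by rw [sq_abs]; linarith)
    have h1 : ‖(w t - v t) • f (s - t)‖ ≤ K * (t ^ 2 + (ε ^ 2 + δ ^ 2))⁻¹ * C0norm f := by
      rw [norm_smul, Real.norm_eq_abs]
      exact mul_le_mul (hker t ht) (hf0 _) (norm_nonneg _) (by positivity)
    have h2 : ‖v t • (f (s - t) - f s)‖
        ≤ (t ^ 2 + (ε ^ 2 + δ ^ 2))⁻¹ * C0norm (deriv f) := by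
      have hl := norm_sub_le_of_norm_deriv_le (hf.differentiable (by norm_num)) hf1 (s - t) s
      rw [show s - t - s = -t by ring, abs_neg] at hl
      have hvt : 0 < v t := by positivity
      rw [norm_smul, Real.norm_eq_abs, abs_of_pos hvt]
      calc v t * ‖f (s - t) - f s‖
          ≤ v t * (C0norm (deriv f) * √(t ^ 2 + (ε ^ 2 + δ ^ 2))) := by
            gcongr
            exact hl.trans (by gcongr)
        _ = (√(t ^ 2 + (ε ^ 2 + δ ^ 2)) ^ 2)⁻¹ * C0norm (deriv f) := by
            simp only [v]
            field_simp
        _ = _ := by rw [hb2]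
    have e : w t • f (s - t) - v t • f s
        = (w t - v t) • f (s - t) + v t • (f (s - t) - f s) := by
      rw [sub_smul, smul_sub]
      abel
    rw [e]
    refine (norm_add_le _ _).trans ((add_le_add h1 h2).trans ?_)
    have hi : 0 < (t ^ 2 + (ε ^ 2 + δ ^ 2))⁻¹ := by positivity
    unfold C1norm
    nlinarith [mul_nonneg hi.le hM0, mul_nonneg (mul_nonneg hK0.le hi.le) hM1]
  have hC1 : 0 ≤ C1norm f := add_nonneg hM0 hM1
  have hI1 : ‖∫ t in (-(1:ℝ)/2)..(1/2), (w t • f (s - t) - v t • f s)‖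
      ≤ (K + 1) * C1norm f * (Real.pi / η) := by
    calc ‖∫ t in (-(1:ℝ)/2)..(1/2), (w t • f (s - t) - v t • f s)‖
        ≤ ∫ t in (-(1:ℝ)/2)..(1/2),
            (K + 1) * C1norm f * (t ^ 2 + (ε ^ 2 + δ ^ 2))⁻¹ := by
          refine intervalIntegral.norm_integral_le_of_norm_le (by norm_num)
            (ae_of_all _ fun t ht => hpt t ?_)
            ((hcinv.const_mul _).intervalIntegrable _ _)
          rw [abs_le]
          constructor <;> linarith [ht.1, ht.2]
      _ ≤ _ := by
          rw [intervalIntegral.integral_const_mul]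
          gcongr
  have hI2 : ‖((∫ t in (-(1:ℝ)/2)..(1/2), v t) - 2 / (ε ^ 2 + δ ^ 2)) • f s‖
      ≤ 4 / η * C1norm f := by
    rw [norm_smul, Real.norm_eq_abs]
    exact mul_le_mul hmain ((hf0 s).trans (le_add_of_nonneg_right hM1)) (norm_nonneg _)
      (by positivity)
  have hsplit : δ ^ 2 • (∫ t in (-(1:ℝ)/2)..(1/2), w t • f (s - t))
        - (2 * δ ^ 2 / (ε ^ 2 + δ ^ 2)) • f s
      = δ ^ 2 • ((∫ t in (-(1:ℝ)/2)..(1/2), (w t • f (s - t) - v t • f s))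
        + ((∫ t in (-(1:ℝ)/2)..(1/2), v t) - 2 / (ε ^ 2 + δ ^ 2)) • f s) := by
    have hwi : Continuous fun t => w t • f (s - t) := by fun_prop
    have hvi : Continuous fun t => v t • f s := by fun_prop
    rw [intervalIntegral.integral_sub (hwi.intervalIntegrable _ _) (hvi.intervalIntegrable _ _),
      intervalIntegral.integral_smul_const, sub_smul,
      show 2 * δ ^ 2 / (ε ^ 2 + δ ^ 2) = δ ^ 2 * (2 / (ε ^ 2 + δ ^ 2)) by ring, mul_smul,
      ← smul_sub]
    congr 1
    abel
  rw [hsplit, norm_smul, Real.norm_eq_abs, abs_of_pos (show 0 < δ ^ 2 by positivity)]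
  calc _ ≤ δ ^ 2 * ((K + 1) * C1norm f * (Real.pi / η) + 4 / η * C1norm f) := by
        gcongr
        exact (norm_add_le _ _).trans (add_le_add hI1 hI2)
    _ = _ := by ring
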